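/- Under the setting of the previous statement, suppose in addition that D > 0 and the step size is constant: β^{(T)} = β = D / ( M · (∑_{t=T₀}^{T̄} t²)^{1/2} ) for all T ∈ {T₀, …, T̄}, with T₀ ≥ 1. Then min_{T ∈ {T₀,…,T̄}} ‖A^{(T)} − Ā‖_F ≤ (D·M/c) · ( (∑_{t=T₀}^{T̄} t²)^{1/2} / ∑_{t=T₀}^{T̄} t ). -/

import Mathlib

open Matrix

/-- The Frobenius inner product `⟨X, Y⟩ = tr(Xᵀ Y)` on `ℝ^{n×n}`. -/
noncomputable def finner {n : ℕ} (X Y : Matrix (Fin n) (Fin n) ℝ) : ℝ :=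
  (Xᵀ * Y).trace

/-- The Frobenius norm on `ℝ^{n×n}`. -/
noncomputable def fnorm {n : ℕ} (X : Matrix (Fin n) (Fin n) ℝ) : ℝ :=
  Real.sqrt (finner X X)

/-- `G` is a subgradient of `f : ℝ^{n×n} → ℝ` at `A` if
`f(B) ≥ f(A) + ⟨G, B − A⟩` for all `B`, with the Frobenius inner product. -/
def IsMatSubgradientAt {n : ℕ} (f : Matrix (Fin n) (Fin n) ℝ → ℝ)
    (G A : Matrix (Fin n) (Fin n) ℝ) : Prop :=
  ∀ B, f B ≥ f A + finner G (B - A)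

theorem finner_comm {n : ℕ} (X Y : Matrix (Fin n) (Fin n) ℝ) : finner X Y = finner Y X := by
  unfold finner
  rw [← trace_transpose, transpose_mul, transpose_transpose]

theorem finner_self_nonneg {n : ℕ} (X : Matrix (Fin n) (Fin n) ℝ) : 0 ≤ finner X X := by
  simp only [finner, trace, diag_apply, mul_apply, transpose_apply]
  exact Finset.sum_nonneg fun _ _ => Finset.sum_nonneg fun _ _ => mul_self_nonneg _

theorem fnorm_sq {n : ℕ} (X : Matrix (Fin n) (Fin n) ℝ) : fnorm X ^ 2 = finner X X :=
  Real.sq_sqrt (finner_self_nonneg X)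

theorem fnorm_nonneg {n : ℕ} (X : Matrix (Fin n) (Fin n) ℝ) : 0 ≤ fnorm X :=
  Real.sqrt_nonneg _

theorem finner_sub_right {n : ℕ} (X Y Z : Matrix (Fin n) (Fin n) ℝ) :
    finner X (Y - Z) = finner X Y - finner X Z := by
  simp [finner, mul_sub]

theorem fnorm_sub_smul_sq {n : ℕ} (X G : Matrix (Fin n) (Fin n) ℝ) (b : ℝ) :
    fnorm (X - b • G) ^ 2 = fnorm X ^ 2 - 2 * b * finner G X + b ^ 2 * fnorm G ^ 2 := by
  have h : finner X G = finner G X := finner_comm X G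
  simp only [fnorm_sq]
  simp only [finner, transpose_sub, transpose_smul, sub_mul, mul_sub, Matrix.smul_mul,
    Matrix.mul_smul, trace_sub, trace_smul, smul_eq_mul] at h ⊢
  linear_combination (-b) * h

/-- The squared distance to `B` decreases along a subgradient step taken at a point where `f`
exceeds `f B` by at least `δ`. -/
theorem IsMatSubgradientAt.fnorm_step_sq_le {n : ℕ} {f : Matrix (Fin n) (Fin n) ℝ → ℝ}
    {G A B : Matrix (Fin n) (Fin n) ℝ} (hG : IsMatSubgradientAt f G A) {b K δ : ℝ} (hb : 0 ≤ b)
    (hK : fnorm G ≤ K) (hδ : δ ≤ f A - f B) :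
    fnorm (A - b • G - B) ^ 2 ≤ fnorm (A - B) ^ 2 - 2 * b * δ + b ^ 2 * K ^ 2 := by
  have hB := hG B
  rw [finner_sub_right] at hB
  have hinner : δ ≤ finner G (A - B) := by
    rw [finner_sub_right]
    linarith
  have hK2 : fnorm G ^ 2 ≤ K ^ 2 := pow_le_pow_left₀ (fnorm_nonneg G) hK 2
  rw [sub_right_comm, fnorm_sub_smul_sq]
  gcongr

/-- Deterministic core of Theorem 4 of the paper (constant step size): with
`β^{(T)} = β = D/(M (∑_{t=T₀}^{T̄} t²)^{1/2})` and `D = ‖A^{(T₀)} − Ā‖_F > 0`,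
the minimum solution gap over `[T₀, T̄]` is at most
`(D M / c) · (∑ t²)^{1/2} / ∑ t`. -/
theorem min_solution_gap_constant_step {n : ℕ} (hn : 1 ≤ n)
    (Abar : Matrix (Fin n) (Fin n) ℝ) (T₀ Tbar : ℕ)
    (hT₀ : 1 ≤ T₀) (hT : T₀ ≤ Tbar)
    (f : ℕ → Matrix (Fin n) (Fin n) ℝ → ℝ)
    (hconv : ∀ T ∈ Finset.Icc T₀ Tbar, ConvexOn ℝ Set.univ (f T))
    (β : ℕ → ℝ)
    (A G : ℕ → Matrix (Fin n) (Fin n) ℝ)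
    (hiter : ∀ T ∈ Finset.Icc T₀ Tbar, A (T + 1) = A T - β T • G T)
    (hsub : ∀ T ∈ Finset.Icc T₀ Tbar, IsMatSubgradientAt (f T) (G T) (A T))
    (M c : ℝ) (hM : 0 < M) (hc : 0 < c)
    (hGnorm : ∀ T ∈ Finset.Icc T₀ Tbar, fnorm (G T) ≤ M * (T : ℝ))
    (hsharp : ∀ T ∈ Finset.Icc T₀ Tbar,
      f T (A T) - f T Abar ≥ c * (T : ℝ) * fnorm (A T - Abar))
    (hD : 0 < fnorm (A T₀ - Abar))
    (hstep : ∀ T ∈ Finset.Icc T₀ Tbar,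
      β T = fnorm (A T₀ - Abar)
        / (M * Real.sqrt (∑ t ∈ Finset.Icc T₀ Tbar, (t : ℝ) ^ 2))) :
    (Finset.Icc T₀ Tbar).inf' (Finset.nonempty_Icc.mpr hT)
        (fun T => fnorm (A T - Abar))
      ≤ (fnorm (A T₀ - Abar) * M / c)
          * (Real.sqrt (∑ t ∈ Finset.Icc T₀ Tbar, (t : ℝ) ^ 2)
              / ∑ t ∈ Finset.Icc T₀ Tbar, (t : ℝ)) := by
  set D := fnorm (A T₀ - Abar) with hDdef
  set S := ∑ t ∈ Finset.Icc T₀ Tbar, (t : ℝ) ^ 2 with hSdef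
  set L := ∑ t ∈ Finset.Icc T₀ Tbar, (t : ℝ) with hLdef
  set m := (Finset.Icc T₀ Tbar).inf' (Finset.nonempty_Icc.mpr hT)
    (fun T => fnorm (A T - Abar))
  have hpos : ∀ t ∈ Finset.Icc T₀ Tbar, (0 : ℝ) < t := fun t ht =>
    Nat.cast_pos.mpr (hT₀.trans (Finset.mem_Icc.mp ht).1)
  have hS : 0 < S :=
    Finset.sum_pos (fun t ht => pow_pos (hpos t ht) 2) (Finset.nonempty_Icc.mpr hT)
  have hL : 0 < L := Finset.sum_pos hpos (Finset.nonempty_Icc.mpr hT)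
  have hsqrt : 0 < √S := Real.sqrt_pos.mpr hS
  set b := D / (M * √S) with hbdef
  have hb : 0 < b := by positivity
  have hdescent : ∀ T ∈ Finset.Icc T₀ Tbar,
      fnorm (A (T + 1) - Abar) ^ 2 - fnorm (A T - Abar) ^ 2
        ≤ b ^ 2 * M ^ 2 * (T : ℝ) ^ 2 - 2 * b * c * m * T := by
    intro T hTmem
    have hm : m ≤ fnorm (A T - Abar) := Finset.inf'_le (fun T => fnorm (A T - Abar)) hTmem
    have hgap : c * T * m ≤ f T (A T) - f T Abar :=
      (mul_le_mul_of_nonneg_left hm (mul_pos hc (hpos T hTmem)).le).trans (hsharp T hTmem)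
    have hstep_le := (hsub T hTmem).fnorm_step_sq_le hb.le (hGnorm T hTmem) hgap
    rw [hiter T hTmem, hstep T hTmem]
    linarith
  have hsum := Finset.sum_le_sum hdescent
  rw [← Finset.Ico_add_one_right_eq_Icc,
    Finset.sum_Ico_sub (fun T => fnorm (A T - Abar) ^ 2) (by omega),
    Finset.Ico_add_one_right_eq_Icc, Finset.sum_sub_distrib, ← Finset.mul_sum,
    ← Finset.mul_sum, ← hSdef, ← hLdef, ← hDdef] at hsum
  have hbM : b ^ 2 * M ^ 2 * S = D ^ 2 := by
    rw [hbdef, div_pow, mul_pow, Real.sq_sqrt hS.le]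
    field_simp
  have hbcm : b * (c * m * L) ≤ b * (D * M * √S) := by
    have hbD : b * (D * M * √S) = D ^ 2 := by
      rw [hbdef]
      field_simp
    linarith [sq_nonneg (fnorm (A (Tbar + 1) - Abar))]
  have hcm : c * m * L ≤ D * M * √S := le_of_mul_le_mul_left hbcm hb
  rw [div_mul_div_comm, le_div_iff₀ (mul_pos hc hL)]
  linarith
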